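/- Let Γ be a plumbing tree with framing matrix B, let v_i be a vertex of Γ with weight m_1, and let Γ∘ be the plumbing tree obtained from Γ by the move (B+): a new leaf w of weight +1 is attached by an edge to v_i, and the weight of v_i is changed to m_1 + 1 (all other vertices, weights, and edges unchanged). If B∘ denotes the framing matrix of Γ∘, then n_+(B∘) = n_+(B) + 1 and n_-(B∘) = n_-(B). -/

import Mathlib

/-- A plumbing tree: a finite tree with integer vertex weights (Euler numbers). -/
structure PlumbingTree (V : Type) [Fintype V] where
  adj : SimpleGraph V
  isTree : adj.IsTree
  weight : V → ℤ

open Classical in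
/-- The framing matrix of a plumbing tree, viewed as a real symmetric matrix. -/
noncomputable def framing {V : Type} [Fintype V] (Γ : PlumbingTree V) :
    Matrix V V ℝ :=
  Matrix.of fun i j =>
    if i = j then (Γ.weight i : ℝ) else if Γ.adj.Adj i j then 1 else 0

/-- The number of positive eigenvalues (with multiplicity) of a symmetric real matrix. -/
noncomputable def nPos {V : Type} [Fintype V] [DecidableEq V] (A : Matrix V V ℝ) : ℕ :=
  if h : A.IsHermitian then Nat.card {i // 0 < h.eigenvalues i} else 0

/-- The number of negative eigenvalues (with multiplicity) of a symmetric real matrix. -/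
noncomputable def nNeg {V : Type} [Fintype V] [DecidableEq V] (A : Matrix V V ℝ) : ℕ :=
  if h : A.IsHermitian then Nat.card {i // h.eigenvalues i < 0} else 0

open QuadraticMap in
/-- The quadratic form of a real symmetric matrix is diagonalized by an orthonormal eigenbasis. -/
theorem equivalent_weightedSumSquares_eigenvalues {n : Type*} [Fintype n] [DecidableEq n]
    {A : Matrix n n ℝ} (hA : A.IsHermitian) :
    Equivalent A.toQuadraticForm' (weightedSumSquares ℝ hA.eigenvalues) := by
  set U : Matrix n n ℝ := (hA.eigenvectorUnitary : Matrix n n ℝ)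
  have hUU : U * U.transpose = 1 := by
    simpa [Matrix.star_eq_conjTranspose] using
      Unitary.coe_mul_star_self hA.eigenvectorUnitary
  have hUU' : U.transpose * U = 1 := mul_eq_one_comm.mp hUU
  have hspec : A = U * Matrix.diagonal hA.eigenvalues * U.transpose := by
    have h := hA.spectral_theorem
    rw [Unitary.conjStarAlgAut_apply] at h
    simpa [Matrix.star_eq_conjTranspose, Function.comp_def] using h
  refine ⟨⟨Matrix.toLin'OfInv hUU hUU', fun x => ?_⟩⟩
  have h : A.toQuadraticForm' x = x ⬝ᵥ (A.mulVec x) := by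
    simp [Matrix.toQuadraticForm', Matrix.toLinearMap₂'_apply']
  rw [h]
  conv_rhs => rw [hspec]
  rw [← Matrix.mulVec_mulVec, ← Matrix.mulVec_mulVec, Matrix.dotProduct_mulVec,
    ← Matrix.mulVec_transpose]
  simp only [weightedSumSquares_apply, dotProduct, Matrix.mulVec_diagonal, smul_eq_mul]
  refine Finset.sum_congr rfl fun i _ => ?_
  change hA.eigenvalues i * (Matrix.toLin' U.transpose x i * Matrix.toLin' U.transpose x i) = _
  rw [Matrix.toLin'_apply]
  ring

theorem nPos_eq_sigPos {V : Type} [Fintype V] [DecidableEq V] {A : Matrix V V ℝ}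
    (hA : A.IsHermitian) : nPos A = sigPos A.toQuadraticForm' := by
  rw [QuadraticForm.sigPos_of_equiv_weightedSumSquares
    (equivalent_weightedSumSquares_eigenvalues hA), nPos, dif_pos hA]
  rfl

theorem nNeg_eq_sigNeg {V : Type} [Fintype V] [DecidableEq V] {A : Matrix V V ℝ}
    (hA : A.IsHermitian) : nNeg A = sigNeg A.toQuadraticForm' := by
  rw [QuadraticForm.sigNeg_of_equiv_weightedSumSquares
    (equivalent_weightedSumSquares_eigenvalues hA), nNeg, dif_pos hA]
  rfl

theorem framing_isHermitian {V : Type} [Fintype V] (Γ : PlumbingTree V) :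
    (framing Γ).IsHermitian := by
  ext i j
  by_cases h : i = j
  · simp [h]
  · by_cases hadj : Γ.adj.Adj i j
    · simp [framing, h, Ne.symm h, hadj, hadj.symm]
    · simp [framing, h, Ne.symm h, hadj, mt SimpleGraph.Adj.symm hadj]

open QuadraticMap in
/-- Adding the square of an independent linear form to a diagonalized quadratic form
adds a weight `1` to the diagonalization. -/
theorem equivalent_weightedSumSquares_option {V W : Type*} [Fintype V] [Fintype W]
    {Q : QuadraticForm ℝ (V → ℝ)} {Q' : QuadraticForm ℝ (W → ℝ)} {c : V → ℝ}
    (hQ : Equivalent Q (weightedSumSquares ℝ c)) (e : Option V ≃ W) (vi : V)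
    (h : ∀ x, Q' x = Q (fun v => x (e (some v))) + (x (e none) + x (e (some vi))) ^ 2) :
    Equivalent Q' (weightedSumSquares ℝ fun o : Option V => o.elim 1 c) := by
  obtain ⟨T⟩ := hQ
  let L : (W → ℝ) →ₗ[ℝ] (Option V → ℝ) := LinearMap.pi fun o : Option V => o.elim
    ((LinearMap.proj (e none) : (W → ℝ) →ₗ[ℝ] ℝ) + LinearMap.proj (e (some vi)))
    (fun v => LinearMap.proj v ∘ₗ T.toLinearEquiv.toLinearMap ∘ₗ
      LinearMap.funLeft ℝ ℝ (fun v => e (some v)))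
  have hL_none (x) : L x none = x (e none) + x (e (some vi)) := rfl
  have hL_some (x) (v) : L x (some v) = T (fun v => x (e (some v))) v := rfl
  have hinj : Function.Injective L := by
    rw [injective_iff_map_eq_zero]
    intro x hx
    have hT : (fun v => x (e (some v))) = 0 := by
      apply T.toLinearEquiv.map_eq_zero_iff.mp
      funext v
      exact congrFun hx (some v)
    have hn : x (e none) = 0 := by
      have := congrFun hx none
      rw [hL_none, show x (e (some vi)) = 0 from congrFun hT vi] at this
      simpa using this
    funext y
    obtain ⟨o, rfl⟩ := e.surjective y
    cases o with
    | none => exact hn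
    | some v => exact congrFun hT v
  have hfin : Module.finrank ℝ (W → ℝ) = Module.finrank ℝ (Option V → ℝ) := by
    simp only [Module.finrank_fintype_fun_eq_card]
    exact (Fintype.card_congr e).symm
  refine ⟨⟨L.linearEquivOfInjective hinj hfin, fun x => ?_⟩⟩
  change weightedSumSquares ℝ _ (L x) = _
  rw [h, weightedSumSquares_apply, Fintype.sum_option, hL_none,
    ← T.map_app (fun v => x (e (some v))), weightedSumSquares_apply]
  simp only [hL_some, Option.elim, smul_eq_mul]
  ring

theorem toQuadraticForm'_apply_sum {n : Type*} [Fintype n] [DecidableEq n] (A : Matrix n n ℝ)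
    (x : n → ℝ) : A.toQuadraticForm' x = ∑ i, ∑ j, x i * A i j * x j := by
  simp [Matrix.toQuadraticForm', Matrix.toLinearMap₂'_apply', dotProduct, Matrix.mulVec,
    Finset.mul_sum, mul_assoc]

/-- **Neumann move (B+) and the signature.**
If `Γ'` is obtained from the plumbing tree `Γ` by the move (B+) — a new leaf
`w` of weight `+1` is attached by an edge to the vertex `vi`, whose weight
increases by `1`, everything else unchanged — then `n₊(B∘) = n₊(B) + 1` and
`n₋(B∘) = n₋(B)` for the framing matrices. -/
theorem neumann_move_B_pos_signature
    {V W : Type} [Fintype V] [DecidableEq V] [Fintype W] [DecidableEq W]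
    (Γ : PlumbingTree V) (Γ' : PlumbingTree W)
    (vi : V)
    (f : V → W) (w : W)
    (hf : Function.Injective f)
    (hw : ∀ v, f v ≠ w)
    (hsurj : ∀ x : W, x = w ∨ ∃ v, f v = x)
    (hwi : Γ'.weight (f vi) = Γ.weight vi + 1)
    (hwother : ∀ v, v ≠ vi → Γ'.weight (f v) = Γ.weight v)
    (hww : Γ'.weight w = 1)
    (hadjw : ∀ v, Γ'.adj.Adj w (f v) ↔ v = vi)
    (hadjf : ∀ a b, Γ'.adj.Adj (f a) (f b) ↔ Γ.adj.Adj a b) :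
    nPos (framing Γ') = nPos (framing Γ) + 1 ∧
    nNeg (framing Γ') = nNeg (framing Γ) := by
  classical
  let g : Option V → W := fun o => o.elim w f
  have hg : Function.Bijective g := by
    constructor
    · rintro (_ | a) (_ | b) h
      · rfl
      · exact absurd h.symm (hw b)
      · exact absurd h (hw a)
      · exact congrArg some (hf h)
    · intro x
      obtain rfl | ⟨v, rfl⟩ := hsurj x
      exacts [⟨none, rfl⟩, ⟨some v, rfl⟩]
  let e : Option V ≃ W := Equiv.ofBijective g hg
  have h_ww : framing Γ' w w = 1 := by simp [framing, hww]
  have h_wf (v) : framing Γ' w (f v) = if v = vi then 1 else 0 := by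
    simp [framing, (hw v).symm, hadjw]
  have h_fw (v) : framing Γ' (f v) w = if v = vi then 1 else 0 := by
    simp [framing, hw v, Γ'.adj.adj_comm (f v) w, hadjw]
  have h_ff (a b) : framing Γ' (f a) (f b) =
      framing Γ a b + if a = vi then (if b = vi then 1 else 0) else 0 := by
    by_cases hab : a = b
    · subst hab
      by_cases ha : a = vi
      · subst ha
        simp [framing, hwi]
      · simp [framing, hwother a ha, ha]
    · have hne : ¬ (a = vi ∧ b = vi) := fun h => hab (h.1.trans h.2.symm)
      simp only [framing, Matrix.of_apply, hf.eq_iff, hab, hadjf, if_false, ← ite_and, hne,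
        add_zero]
  have hQ (x : W → ℝ) : (framing Γ').toQuadraticForm' x =
      (framing Γ).toQuadraticForm' (fun v => x (e (some v))) +
        (x (e none) + x (e (some vi))) ^ 2 := by
    have he_none : e none = w := rfl
    have he_some (v) : e (some v) = f v := rfl
    simp only [toQuadraticForm'_apply_sum]
    rw [← e.sum_comp]
    simp only [← e.sum_comp (fun j => x _ * framing Γ' _ j * x j), Fintype.sum_option, he_none,
      he_some, h_ww, h_wf, h_fw, h_ff, mul_add, add_mul, Finset.sum_add_distrib]
    simp
    ring
  have hdiag := equivalent_weightedSumSquares_eigenvalues (framing_isHermitian Γ)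
  have hdiag' := equivalent_weightedSumSquares_option hdiag e vi hQ
  rw [nPos_eq_sigPos (framing_isHermitian Γ'), nPos_eq_sigPos (framing_isHermitian Γ),
    nNeg_eq_sigNeg (framing_isHermitian Γ'), nNeg_eq_sigNeg (framing_isHermitian Γ),
    QuadraticForm.sigPos_of_equiv_weightedSumSquares hdiag,
    QuadraticForm.sigPos_of_equiv_weightedSumSquares hdiag',
    QuadraticForm.sigNeg_of_equiv_weightedSumSquares hdiag,
    QuadraticForm.sigNeg_of_equiv_weightedSumSquares hdiag']
  simp only [Set.ncard_eq_toFinset_card', Set.toFinset_ofPred, Finset.card_filter,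
    Fintype.sum_option, Option.elim]
  norm_num
  exact add_comm _ _
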